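/- Let R be a regular local ring with maximal ideal I generated minimally by f_1,...,f_n. For a vector m ∈ ℕ^n, define the monomial valuation ideal I_m^μ to be the ideal generated by all monomials f_1^{a_1}···f_n^{a_n} with Σ a_i m_i ≥ μ. Then for any m, m' ∈ ℕ^n and positive integers μ, μ', one has I_m^μ ∩ I_{m'}^{μ'} ⊆ I_{m+m'}^{μ+μ'}. -/

import Mathlib

/-- The monomial valuation ideal: the ideal generated by all monomials
`f 1 ^ a 1 * ⋯ * f n ^ a n` with `∑ a i * m i ≥ μ`. -/
def monomialValIdeal {R : Type*} [CommRing R] {n : ℕ} (f : Fin n → R)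
    (m : Fin n → ℕ) (μ : ℕ) : Ideal R :=
  Ideal.span {x : R | ∃ a : Fin n → ℕ, μ ≤ ∑ i, a i * m i ∧ x = ∏ i, f i ^ a i}

open IsLocalRing in
/-- The maximal ideal of a quotient of a local ring is generated by the images of generators
outside the ideal. -/
lemma maximalIdeal_quotient_eq_span {R : Type*} [CommRing R] [IsLocalRing R] {J : Ideal R}
    [IsLocalRing (R ⧸ J)] {t : Set R} (hJ : J ≤ maximalIdeal R)
    (h : maximalIdeal R ≤ J ⊔ Ideal.span t) (ht : t ⊆ maximalIdeal R) :
    maximalIdeal (R ⧸ J) = Ideal.span (Ideal.Quotient.mk J '' t) := by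
  have hm : maximalIdeal R = J ⊔ Ideal.span t :=
    le_antisymm h (sup_le hJ (Ideal.span_le.mpr ht))
  rw [← map_maximalIdeal_of_surjective _ (Ideal.Quotient.mk_surjective (I := J)), hm,
    Ideal.map_sup, Ideal.map_quotient_self, bot_sup_eq, Ideal.map_span]

open IsLocalRing in
/-- A Noetherian local ring whose maximal ideal is generated by at most `dim R` elements is a
domain. -/
theorem isDomain_of_maximalIdeal_eq_span {R : Type*} [CommRing R] [IsNoetherianRing R]
    [IsLocalRing R] (N : ℕ) (s : Finset R) (hs : maximalIdeal R = Ideal.span s)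
    (hcard : s.card ≤ N) (hdim : (N : WithBot ℕ∞) ≤ ringKrullDim R) : IsDomain R := by
  induction N generalizing R with
  | zero =>
    obtain rfl : s = ∅ := by simpa using hcard
    exact (isField_iff_maximalIdeal_eq.mpr (by simpa using hs)).isDomain
  | succ N ih =>
    have hmin : maximalIdeal R ∉ minimalPrimes R := fun h ↦ by
      rw [← Ideal.height_eq_zero_iff] at h
      rw [← maximalIdeal_height_eq_ringKrullDim, h] at hdim
      simp at hdim
    have hbot : maximalIdeal R ≠ ⊥ := fun h ↦ hmin (by
      refine ⟨⟨inferInstance, bot_le⟩, fun q _ _ ↦ ?_⟩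
      rw [h]; exact bot_le)
    have hjac : maximalIdeal R ≤ (⊥ : Ideal R).jacobson :=
      (jacobson_eq_maximalIdeal ⊥ bot_ne_top).ge
    obtain ⟨x, hxm, hx⟩ : ∃ x ∈ maximalIdeal R,
        x ∉ ⋃ I ∈ insert (maximalIdeal R ^ 2) (minimalPrimes R), (I : Set R) := by
      by_contra! hcon
      obtain ⟨I, hI, hle⟩ := (Ideal.subset_union_prime_finite (f := id)
        ((minimalPrimes.finite_of_isNoetherianRing R).insert (maximalIdeal R ^ 2))
        (maximalIdeal R ^ 2) (maximalIdeal R ^ 2) (by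
          rintro i (rfl | hi) h1 -
          · exact absurd rfl h1
          · exact hi.1.1)).mp hcon
      obtain rfl | hI := hI
      · refine hbot (Submodule.eq_bot_of_le_smul_of_le_jacobson_bot (maximalIdeal R) _
          (IsNoetherian.noetherian _) ?_ hjac)
        simpa [pow_two] using hle
      · have := hI.1.1
        have : I = maximalIdeal R := le_antisymm (le_maximalIdeal hI.1.1.ne_top) hle
        exact hmin (this ▸ hI)
    simp only [Set.mem_insert_iff, Set.iUnion_iUnion_eq_or_left, Set.mem_union, SetLike.mem_coe,
      Set.mem_iUnion, exists_prop, not_or, not_exists, not_and] at hx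
    obtain ⟨hx2, hxmin⟩ := hx
    classical
    obtain ⟨c, -, hc⟩ := Submodule.mem_span_finset.mp (hs ▸ hxm : x ∈ Ideal.span (s : Set R))
    have hsm : ∀ a ∈ s, a ∈ maximalIdeal R := fun a ha ↦ hs ▸ Ideal.subset_span ha
    obtain ⟨i, his, hi⟩ : ∃ i ∈ s, IsUnit (c i) := by
      by_contra! hcon
      refine hx2 (hc ▸ Ideal.sum_mem _ fun a ha ↦ ?_)
      rw [pow_two]
      exact Ideal.mul_mem_mul (hcon a ha) (hsm a ha)
    have hJ : Ideal.span {x} ≤ maximalIdeal R := (Ideal.span_singleton_le_iff_mem _).mpr hxm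
    have : Nontrivial (R ⧸ Ideal.span {x}) := Ideal.Quotient.nontrivial_iff.mpr
      (fun h ↦ (maximalIdeal.isMaximal R).ne_top (top_le_iff.mp (h ▸ hJ)))
    have : IsLocalRing (R ⧸ Ideal.span {x}) :=
      of_surjective' (Ideal.Quotient.mk _) Ideal.Quotient.mk_surjective
    have hgen : maximalIdeal R ≤ Ideal.span {x} ⊔ Ideal.span (s.erase i : Set R) := by
      rw [hs, Ideal.span_le]
      intro a ha
      by_cases hai : a = i
      · subst hai
        have h1 : c a * a = x - ∑ b ∈ s.erase a, c b * b := by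
          rw [← hc, ← Finset.add_sum_erase _ _ his]; simp
        refine (Ideal.unit_mul_mem_iff_mem _ hi).mp ?_
        rw [h1]
        refine Ideal.sub_mem _ (Ideal.mem_sup_left (Ideal.mem_span_singleton_self x))
          (Ideal.mem_sup_right (Ideal.sum_mem _ fun b hb ↦ ?_))
        exact Ideal.mul_mem_left _ _ (Ideal.subset_span hb)
      · exact Ideal.mem_sup_right (Ideal.subset_span (by simp [hai, Finset.mem_coe.mp ha]))
    have hdom : IsDomain (R ⧸ Ideal.span {x}) := by
      refine ih ((s.erase i).image (Ideal.Quotient.mk _)) ?_ ?_ ?_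
      · rw [Finset.coe_image]
        exact maximalIdeal_quotient_eq_span hJ hgen fun a ha ↦ hsm a (Finset.mem_of_mem_erase ha)
      · refine Finset.card_image_le.trans ?_
        rw [Finset.card_erase_of_mem his]
        omega
      · have := Ideal.height_le_ringKrullDim_quotient_add_one hxm
        rw [maximalIdeal_height_eq_ringKrullDim] at this
        have := hdim.trans this
        push_cast at this
        exact ENat.WithBot.add_le_add_one_right_iff.mp this
    have hprime : (Ideal.span {x}).IsPrime := (Ideal.Quotient.isDomain_iff_prime _).mp hdom
    obtain ⟨P, hP, hPx⟩ := Ideal.exists_minimalPrimes_le (bot_le : ⊥ ≤ Ideal.span {x})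
    have hPprime := hP.1.1
    have hP0 : P = ⊥ := by
      refine Submodule.eq_bot_of_le_smul_of_le_jacobson_bot (Ideal.span {x}) _
          (IsNoetherian.noetherian _) (fun y hy ↦ ?_) (hJ.trans hjac)
      obtain ⟨z, rfl⟩ := Ideal.mem_span_singleton'.mp (hPx hy)
      rw [mul_comm, smul_eq_mul]
      exact Ideal.mul_mem_mul (Ideal.mem_span_singleton_self x)
        ((hPprime.mem_or_mem hy).resolve_right (hxmin P hP))
    rw [hP0] at hPprime
    exact IsDomain.of_bot_isPrime R

open IsLocalRing in
/-- Any subset of a regular system of parameters generates a prime ideal. -/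
theorem isPrime_span_image_of_regularSystem {R ι : Type*} [CommRing R] [IsNoetherianRing R]
    [IsLocalRing R] [Fintype ι] (f : ι → R) (hgen : maximalIdeal R = Ideal.span (Set.range f))
    (hreg : ringKrullDim R = Fintype.card ι) (S : Finset ι) :
    (Ideal.span (f '' S)).IsPrime := by
  classical
  have hfm (i) : f i ∈ maximalIdeal R := hgen ▸ Ideal.subset_span ⟨i, rfl⟩
  have hJ : Ideal.span (f '' S) ≤ maximalIdeal R := by
    rw [Ideal.span_le]
    rintro _ ⟨i, -, rfl⟩
    exact hfm i
  have : Nontrivial (R ⧸ Ideal.span (f '' S)) := Ideal.Quotient.nontrivial_iff.mpr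
    (fun h ↦ (maximalIdeal.isMaximal R).ne_top (top_le_iff.mp (h ▸ hJ)))
  have : IsLocalRing (R ⧸ Ideal.span (f '' S)) :=
    of_surjective' (Ideal.Quotient.mk _) Ideal.Quotient.mk_surjective
  rw [← Ideal.Quotient.isDomain_iff_prime]
  refine isDomain_of_maximalIdeal_eq_span Sᶜ.card
    ((Sᶜ.image f).image (Ideal.Quotient.mk _)) ?_
    (Finset.card_image_le.trans Finset.card_image_le) ?_
  · rw [Finset.coe_image]
    refine maximalIdeal_quotient_eq_span hJ ?_ ?_
    · rw [hgen, ← Ideal.span_union, Finset.coe_image, ← Set.image_union]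
      simp
    · simp only [Finset.coe_image]
      rintro _ ⟨i, -, rfl⟩
      exact hfm i
  · have h1 := ringKrullDim_le_ringKrullDim_quotient_add_card (S.image f) (by
      rw [ringJacobson_eq_maximalIdeal, Finset.coe_image]
      rintro _ ⟨i, -, rfl⟩
      exact hfm i)
    rw [Finset.coe_image, hreg, ← Finset.card_compl_add_card S] at h1
    have h2 : ((Finset.card (S.image f) : ℕ) : WithBot ℕ∞) ≤ (S.card : ℕ) :=
      Nat.cast_le.mpr Finset.card_image_le
    have h3 := h1.trans (add_le_add le_rfl h2)
    push_cast at h3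
    exact ENat.WithBot.add_le_add_natCast_right_iff.mp h3

namespace MvPolynomial

variable {R ι : Type*} [CommRing R]

/-- Homogeneous polynomials of degree `d` in the variables in `S` with coefficients in `K`. -/
def homogeneousIn (S : Set ι) (d : ℕ) (K : Ideal R) : Submodule R (MvPolynomial ι R) where
  carrier := {F | ∀ a, coeff a F ∈ K ∧ (coeff a F ≠ 0 → ↑a.support ⊆ S ∧ a.degree = d)}
  zero_mem' a := by simp
  add_mem' {F G} hF hG a := by
    refine ⟨by simpa using K.add_mem (hF a).1 (hG a).1, fun h ↦ ?_⟩
    by_cases h1 : coeff a F = 0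
    · exact (hG a).2 fun h2 ↦ h (by simp [h1, h2])
    · exact (hF a).2 h1
  smul_mem' c F hF a := by
    refine ⟨by simpa using K.mul_mem_left c (hF a).1, fun h ↦ (hF a).2 fun h1 ↦ h ?_⟩
    simp [h1]

lemma homogeneousIn_mono {S T : Set ι} (hST : S ⊆ T) {d : ℕ} {K L : Ideal R} (hKL : K ≤ L) :
    homogeneousIn S d K ≤ homogeneousIn T d L :=
  fun _ hF a ↦ ⟨hKL (hF a).1, fun h ↦ ⟨((hF a).2 h).1.trans hST, ((hF a).2 h).2⟩⟩

lemma monomial_mem_homogeneousIn {S : Set ι} {a : ι →₀ ℕ} (ha : ↑a.support ⊆ S) {K : Ideal R}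
    {c : R} (hc : c ∈ K) : monomial a c ∈ homogeneousIn S a.degree K := by
  classical
  intro b
  rw [coeff_monomial]
  split_ifs with h
  · subst h
    exact ⟨hc, fun _ ↦ ⟨ha, rfl⟩⟩
  · simp

lemma X_mul_mem_homogeneousIn {S : Set ι} {i : ι} (hi : i ∈ S) {d : ℕ} {K : Ideal R}
    {F : MvPolynomial ι R} (hF : F ∈ homogeneousIn S d K) :
    X i * F ∈ homogeneousIn S (d + 1) K := by
  classical
  intro a
  rw [coeff_X_mul']
  split_ifs with ha
  · refine ⟨(hF _).1, fun h ↦ ?_⟩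
    obtain ⟨h1, h2⟩ := (hF _).2 h
    have hle : Finsupp.single i 1 ≤ a := by
      rw [Finsupp.single_le_iff]
      exact Nat.one_le_iff_ne_zero.mpr (Finsupp.mem_support_iff.mp ha)
    have hadd := tsub_add_cancel_of_le hle
    constructor
    · intro j hj
      by_cases hji : j = i
      · exact hji ▸ hi
      · refine h1 ?_
        simp only [Finset.mem_coe, Finsupp.mem_support_iff] at hj ⊢
        simpa [Finsupp.single_apply, Ne.symm hji] using hj
    · rw [← hadd, map_add, h2]
      simp
  · simp

lemma eval_mem_pow_mul {f : ι → R} [Fintype ι] {S : Set ι} {d : ℕ} {K : Ideal R}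
    {F : MvPolynomial ι R} (hF : F ∈ homogeneousIn S d K) :
    eval f F ∈ Ideal.span (f '' S) ^ d * K := by
  rw [eval_eq']
  refine Ideal.sum_mem _ fun a ha ↦ ?_
  obtain ⟨h1, h2⟩ := (hF a).2 (mem_support_iff.mp ha)
  rw [mul_comm (coeff a F)]
  refine Ideal.mul_mem_mul ?_ (hF a).1
  rw [← h2, Finsupp.degree_eq_sum, ← Finset.prod_pow_eq_pow_sum]
  refine Ideal.prod_mem_prod fun i _ ↦ ?_
  by_cases hi : i ∈ S
  · exact Ideal.pow_mem_pow (Ideal.subset_span (Set.mem_image_of_mem f hi)) _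
  · have : a i = 0 := by
      by_contra h
      exact hi (h1 (by simpa using h))
    simp [this]

lemma exists_eval_eq_of_mem_pow_mul {f : ι → R} {S : Set ι} {d : ℕ} {K : Ideal R} {y : R}
    (hy : y ∈ Ideal.span (f '' S) ^ d * K) : ∃ F ∈ homogeneousIn S d K, eval f F = y := by
  induction d generalizing y with
  | zero =>
    refine ⟨monomial 0 y, ?_, by simp⟩
    simpa using monomial_mem_homogeneousIn (S := S) (a := 0) (by simp) (by simpa using hy)
  | succ d ih =>
    rw [pow_succ', mul_assoc] at hy
    let W := (homogeneousIn S (d + 1) K).map (aeval f).toLinearMap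
    suffices Ideal.span (f '' S) * (Ideal.span (f '' S) ^ d * K) ≤ W by
      obtain ⟨F, hF, hFy⟩ := this hy
      exact ⟨F, hF, by simpa [aeval_eq_eval] using hFy⟩
    rw [Ideal.mul_le]
    intro r hr z hz
    obtain ⟨F, hF, rfl⟩ := ih hz
    induction hr using Submodule.span_induction with
    | mem r hr =>
      obtain ⟨i, hi, rfl⟩ := hr
      exact ⟨X i * F, X_mul_mem_homogeneousIn hi hF, by simp [aeval_eq_eval]⟩
    | zero => simp
    | add r s _ _ h1 h2 => rw [add_mul]; exact W.add_mem h1 h2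
    | smul c r _ h => rw [smul_mul_assoc]; exact W.smul_mem c h

/-- The family `f`, restricted to `S`, is quasi-regular: a homogeneous form of degree `d` whose
value at `f` lies in `(f_i : i ∈ S) ^ (d + 1)` has all its coefficients in `(f_i : i ∈ S)`. -/
def IsQuasiRegularOn (f : ι → R) (S : Set ι) : Prop :=
  ∀ d, ∀ F ∈ homogeneousIn S d (⊤ : Ideal R), eval f F ∈ Ideal.span (f '' S) ^ (d + 1) →
    ∀ a, coeff a F ∈ Ideal.span (f '' S)

lemma eq_C_of_mem_homogeneousIn_zero {S : Set ι} {K : Ideal R} {F : MvPolynomial ι R}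
    (hF : F ∈ homogeneousIn S 0 K) : F = C (coeff 0 F) := by
  classical
  ext a
  rw [coeff_C]
  split_ifs with h
  · rw [h]
  · by_contra h1
    exact h ((Finsupp.degree_eq_zero_iff a).mp ((hF a).2 h1).2).symm

lemma coeff_mem_of_mem_homogeneousIn_zero {f : ι → R} {S : Set ι} {K L : Ideal R}
    {F : MvPolynomial ι R} (hF : F ∈ homogeneousIn S 0 K) (h : eval f F ∈ L) (a : ι →₀ ℕ) :
    coeff a F ∈ L := by
  classical
  rw [eq_C_of_mem_homogeneousIn_zero hF] at h ⊢
  rw [coeff_C]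
  split_ifs
  · simpa using h
  · simp

lemma isQuasiRegularOn_empty (f : ι → R) : IsQuasiRegularOn f ∅ := by
  intro d F hF h a
  by_cases hd : d = 0
  · subst hd
    exact coeff_mem_of_mem_homogeneousIn_zero hF (by simpa using h) a
  · by_contra h1
    have := (hF a).2 fun h2 ↦ h1 (h2 ▸ zero_mem _)
    obtain rfl : a = 0 := by simpa using this.1
    exact hd (by simpa using this.2.symm)

lemma IsQuasiRegularOn.mem_pow_of_mul_mem_pow [Fintype ι] {f : ι → R} {S : Set ι}
    (h : IsQuasiRegularOn f S) {x : R}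
    (hx : ∀ y, x * y ∈ Ideal.span (f '' S) → y ∈ Ideal.span (f '' S)) (k : ℕ) {y : R}
    (hy : x * y ∈ Ideal.span (f '' S) ^ k) : y ∈ Ideal.span (f '' S) ^ k := by
  induction k with
  | zero => simp
  | succ k ih =>
    have hyk := ih (Ideal.pow_le_pow_right k.le_succ hy)
    obtain ⟨F, hF, rfl⟩ := exists_eval_eq_of_mem_pow_mul (K := ⊤) (by simpa using hyk)
    have hc := h k (x • F) (Submodule.smul_mem _ x hF) (by simpa [smul_eval] using hy)
    rw [pow_succ]
    exact eval_mem_pow_mul fun a ↦ ⟨hx _ (by simpa using hc a), (hF a).2⟩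

lemma IsQuasiRegularOn.insert [Fintype ι] {f : ι → R} {S : Set ι}
    (h : IsQuasiRegularOn f S) {i : ι}
    (hx : ∀ y, f i * y ∈ Ideal.span (f '' S) → y ∈ Ideal.span (f '' S)) :
    IsQuasiRegularOn f (insert i S) := by
  classical
  set J := Ideal.span (f '' S)
  set I := Ideal.span (f '' (Insert.insert i S))
  have hJI : J ≤ I := Ideal.span_mono (Set.image_mono (Set.subset_insert i S))
  have hiI : f i ∈ I := Ideal.subset_span ⟨i, Set.mem_insert i S, rfl⟩
  intro d
  induction d with
  | zero =>
    intro F hF h0 a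
    exact coeff_mem_of_mem_homogeneousIn_zero hF (by simpa using h0) a
  | succ d ih =>
    intro F₀ hF₀ h0
    rw [pow_succ] at h0
    obtain ⟨F₁, hF₁, hF₁e⟩ := exists_eval_eq_of_mem_pow_mul h0
    set F := F₀ - F₁
    have hF : F ∈ homogeneousIn (Insert.insert i S) (d + 1) (⊤ : Ideal R) :=
      Submodule.sub_mem _ hF₀ (homogeneousIn_mono subset_rfl le_top hF₁)
    have hFe : eval f F = 0 := by simp [F, hF₁e]
    suffices ∀ a, coeff a F ∈ I by
      intro a
      have := I.add_mem (this a) (hF₁ a).1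
      simpa [F] using this
    set H := F.divMonomial (Finsupp.single i 1) with hHdef
    set G := F.modMonomial (Finsupp.single i 1) with hGdef
    have hdecomp : X i * H + G = F := divMonomial_add_modMonomial_single F i
    have hH : H ∈ homogeneousIn (Insert.insert i S) d (⊤ : Ideal R) := by
      intro a
      refine ⟨trivial, fun ha ↦ ?_⟩
      rw [hHdef, coeff_divMonomial] at ha
      obtain ⟨h1, h2⟩ := (hF _).2 ha
      refine ⟨fun j hj ↦ h1 ?_, ?_⟩
      · simp only [Finset.mem_coe, Finsupp.mem_support_iff, Finsupp.add_apply] at hj ⊢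
        omega
      · rw [map_add, Finsupp.degree_single] at h2
        omega
    have hG : G ∈ homogeneousIn S (d + 1) (⊤ : Ideal R) := by
      intro a
      refine ⟨trivial, fun ha ↦ ?_⟩
      have hle : ¬ Finsupp.single i 1 ≤ a := fun hle ↦ ha (coeff_modMonomial_of_le F hle)
      rw [hGdef, coeff_modMonomial_of_not_le F hle] at ha
      obtain ⟨h1, h2⟩ := (hF _).2 ha
      refine ⟨fun j hj ↦ (h1 hj).resolve_left ?_, h2⟩
      rintro rfl
      rw [Finsupp.single_le_iff, Nat.one_le_iff_ne_zero] at hle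
      exact hle (by simpa using hj)
    have hsum : f i * eval f H + eval f G = 0 := by
      rw [← hFe, ← hdecomp]; simp
    have hHJ : eval f H ∈ J ^ (d + 1) := by
      refine h.mem_pow_of_mul_mem_pow hx _ ?_
      rw [eq_neg_of_add_eq_zero_left hsum]
      exact neg_mem (by simpa using eval_mem_pow_mul (f := f) hG)
    have hHI := ih H hH (Ideal.pow_right_mono hJI _ hHJ)
    obtain ⟨H', hH', hH'e⟩ := exists_eval_eq_of_mem_pow_mul (K := ⊤) (by simpa using hHJ)
    have hGJ := h (d + 1) (f i • H' + G) (Submodule.add_mem _ (Submodule.smul_mem _ _ hH') hG)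
      (by simp [smul_eval, hH'e, hsum])
    intro a
    rw [← hdecomp, coeff_add]
    refine I.add_mem ?_ ?_
    · rw [coeff_X_mul']
      split_ifs
      · exact hHI _
      · exact I.zero_mem
    · have h1 := I.sub_mem (hJI (hGJ a)) (I.mul_mem_right (coeff a H') hiI)
      simpa using h1

end MvPolynomial

open MvPolynomial in
/-- A regular system of parameters is quasi-regular. -/
theorem isQuasiRegularOn_of_regularSystem {R ι : Type*} [CommRing R] [IsNoetherianRing R]
    [IsLocalRing R] [Fintype ι] (f : ι → R)
    (hgen : IsLocalRing.maximalIdeal R = Ideal.span (Set.range f))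
    (hmin : ∀ i, f i ∉ Ideal.span (f '' {j | j ≠ i}))
    (hreg : ringKrullDim R = Fintype.card ι) (S : Finset ι) :
    IsQuasiRegularOn f (S : Set ι) := by
  classical
  induction S using Finset.induction_on with
  | empty => simpa using isQuasiRegularOn_empty f
  | insert i S hi ih =>
    rw [Finset.coe_insert]
    refine ih.insert fun y hy ↦ ?_
    have := isPrime_span_image_of_regularSystem f hgen hreg S
    refine (this.mem_or_mem hy).resolve_left fun h ↦ hmin i (Ideal.span_mono ?_ h)
    refine Set.image_mono fun j hj ↦ ?_
    rintro rfl
    exact hi hj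

section MonomialIdeal

open MvPolynomial

variable {R ι : Type*} [CommRing R] [Fintype ι]

/-- The ideal generated by the monomials in `f` with exponent in `A`. -/
def monomialIdeal (f : ι → R) (A : Set (ι →₀ ℕ)) : Ideal R :=
  Ideal.span ((fun a ↦ ∏ i, f i ^ a i) '' A)

variable {f : ι → R} {A B : Set (ι →₀ ℕ)}

lemma monomialIdeal_mono (h : A ⊆ B) : monomialIdeal f A ≤ monomialIdeal f B :=
  Ideal.span_mono (Set.image_mono h)

lemma prod_pow_mem_monomialIdeal {a : ι →₀ ℕ} (ha : a ∈ A) :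
    ∏ i, f i ^ a i ∈ monomialIdeal f A :=
  Ideal.subset_span ⟨a, ha, rfl⟩

lemma prod_pow_mem_pow_degree (a : ι →₀ ℕ) :
    ∏ i, f i ^ a i ∈ Ideal.span (Set.range f) ^ a.degree := by
  rw [Finsupp.degree_eq_sum, ← Finset.prod_pow_eq_pow_sum]
  exact Ideal.prod_mem_prod fun i _ ↦ Ideal.pow_mem_pow (Ideal.subset_span (Set.mem_range_self i)) _

lemma monomialIdeal_le_pow {d : ℕ} (hA : ∀ a ∈ A, d ≤ a.degree) :
    monomialIdeal f A ≤ Ideal.span (Set.range f) ^ d := by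
  rw [monomialIdeal, Ideal.span_le]
  rintro _ ⟨a, ha, rfl⟩
  exact Ideal.pow_le_pow_right (hA a ha) (prod_pow_mem_pow_degree a)

/-- Splitting off the lowest-degree form of an element of a monomial ideal. -/
lemma exists_sub_eval_mem_monomialIdeal {d : ℕ} {y : R}
    (hy : y ∈ monomialIdeal f (A ∩ {a | d ≤ a.degree})) :
    ∃ F ∈ homogeneousIn Set.univ d (⊤ : Ideal R), ↑F.support ⊆ A ∧
      y - eval f F ∈ monomialIdeal f (A ∩ {a | d + 1 ≤ a.degree}) := by
  classical
  induction hy using Submodule.span_induction with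
  | mem y hy =>
    obtain ⟨a, ⟨haA, had⟩, rfl⟩ := hy
    obtain rfl | hlt := eq_or_lt_of_le (show d ≤ a.degree from had)
    · refine ⟨monomial a 1, monomial_mem_homogeneousIn (Set.subset_univ _) trivial, ?_, ?_⟩
      · intro b hb
        obtain rfl := Finset.mem_singleton.mp (support_monomial_subset hb)
        exact haA
      · simp [eval_monomial, Finsupp.prod_fintype]
    · refine ⟨0, zero_mem _, by simp, ?_⟩
      simpa using prod_pow_mem_monomialIdeal (f := f)
        (show a ∈ A ∩ {a | d + 1 ≤ a.degree} from ⟨haA, hlt⟩)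
  | zero => exact ⟨0, zero_mem _, by simp, by simp⟩
  | add y z _ _ h1 h2 =>
    obtain ⟨F, hF, hFA, hFy⟩ := h1
    obtain ⟨G, hG, hGA, hGz⟩ := h2
    refine ⟨F + G, Submodule.add_mem _ hF hG, fun a ha ↦ ?_, ?_⟩
    · exact (Finset.mem_union.mp (support_add ha)).elim (fun h ↦ hFA h) (fun h ↦ hGA h)
    · rw [map_add, add_sub_add_comm]
      exact Ideal.add_mem _ hFy hGz
  | smul c y _ h1 =>
    obtain ⟨F, hF, hFA, hFy⟩ := h1
    refine ⟨c • F, Submodule.smul_mem _ c hF, fun a ha ↦ hFA (support_smul ha), ?_⟩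
    rw [smul_eval, smul_eq_mul, ← mul_sub]
    exact Ideal.mul_mem_left _ _ hFy

lemma mul_prod_pow_mem_monomialIdeal (hA : IsUpperSet A) {a : ι →₀ ℕ} (ha : a ∈ A) {c : R}
    (hc : c ∈ Ideal.span (Set.range f)) :
    c * ∏ i, f i ^ a i ∈ monomialIdeal f (A ∩ {b | a.degree + 1 ≤ b.degree}) := by
  classical
  induction hc using Submodule.span_induction with
  | mem c hc =>
    obtain ⟨j, rfl⟩ := hc
    have hmem : a + Finsupp.single j 1 ∈ A ∩ {b | a.degree + 1 ≤ b.degree} :=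
      ⟨hA le_self_add ha, by simp⟩
    convert prod_pow_mem_monomialIdeal (f := f) hmem using 1
    simp only [Finsupp.add_apply, pow_add, Finset.prod_mul_distrib, mul_comm (f j)]
    simp [Finsupp.single_apply, pow_ite]
  | zero => simp
  | add c e _ _ h1 h2 => rw [add_mul]; exact Ideal.add_mem _ h1 h2
  | smul r c _ h => rw [smul_mul_assoc]; exact Submodule.smul_mem _ r h

lemma monomialIdeal_inf_pow_le (hf : IsQuasiRegularOn f Set.univ) (hA : IsUpperSet A) (d : ℕ) :
    monomialIdeal f A ⊓ Ideal.span (Set.range f) ^ d ≤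
      monomialIdeal f (A ∩ {a | d ≤ a.degree}) := by
  induction d with
  | zero => simp
  | succ d ih =>
    rintro y ⟨hyA, hyd⟩
    obtain ⟨F, hF, hFA, hFy⟩ := exists_sub_eval_mem_monomialIdeal
      (ih ⟨hyA, Ideal.pow_le_pow_right d.le_succ hyd⟩)
    have hFd : eval f F ∈ Ideal.span (Set.range f) ^ (d + 1) := by
      have := Ideal.sub_mem _ hyd (monomialIdeal_le_pow (fun a ha ↦ ha.2) hFy)
      simpa using this
    have hc := hf d F hF (by simpa using hFd)
    have hFm : eval f F ∈ monomialIdeal f (A ∩ {a | d + 1 ≤ a.degree}) := by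
      rw [eval_eq']
      refine Ideal.sum_mem _ fun a ha ↦ ?_
      have := mul_prod_pow_mem_monomialIdeal (f := f) hA (hFA ha) (by simpa using hc a)
      rwa [((hF a).2 (mem_support_iff.mp ha)).2] at this
    simpa using Ideal.add_mem _ hFy hFm

/-- Modulo any power of `(f_i)`, an element of the intersection of two monomial ideals in a
quasi-regular family lies in the ideal of common monomials. -/
lemma exists_sub_mem_monomialIdeal_inf_pow (hf : IsQuasiRegularOn f Set.univ)
    (hA : IsUpperSet A) (hB : IsUpperSet B) {x : R} (hxA : x ∈ monomialIdeal f A)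
    (hxB : x ∈ monomialIdeal f B) (d : ℕ) :
    ∃ z ∈ monomialIdeal f (A ∩ B), x - z ∈ Ideal.span (Set.range f) ^ d := by
  classical
  induction d with
  | zero => exact ⟨0, zero_mem _, by simp⟩
  | succ d ih =>
    obtain ⟨z, hz, hxz⟩ := ih
    have hyA := Ideal.sub_mem _ hxA (monomialIdeal_mono Set.inter_subset_left hz)
    have hyB := Ideal.sub_mem _ hxB (monomialIdeal_mono Set.inter_subset_right hz)
    obtain ⟨F, hF, hFA, hFy⟩ := exists_sub_eval_mem_monomialIdeal
      (monomialIdeal_inf_pow_le hf hA d ⟨hyA, hxz⟩)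
    obtain ⟨G, hG, hGB, hGy⟩ := exists_sub_eval_mem_monomialIdeal
      (monomialIdeal_inf_pow_le hf hB d ⟨hyB, hxz⟩)
    have hFy' := monomialIdeal_le_pow (fun a ha ↦ ha.2) hFy
    have hGy' := monomialIdeal_le_pow (fun a ha ↦ ha.2) hGy
    have hc := hf d (F - G) (Submodule.sub_mem _ hF hG) (by
      have := Ideal.sub_mem _ hGy' hFy'
      simpa using this)
    simp only [Set.image_univ, coeff_sub] at hc
    have hcF : ∀ a ∉ B, coeff a F ∈ Ideal.span (Set.range f) := fun a ha ↦ by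
      have h0 : coeff a G = 0 := notMem_support_iff.mp fun h ↦ ha (hGB h)
      simpa [h0] using hc a
    refine ⟨z + ∑ a ∈ F.support with a ∈ B, coeff a F * ∏ i, f i ^ a i,
      Ideal.add_mem _ hz (Ideal.sum_mem _ fun a ha ↦ ?_), ?_⟩
    · rw [Finset.mem_filter] at ha
      exact Ideal.mul_mem_left _ _ (prod_pow_mem_monomialIdeal ⟨hFA ha.1, ha.2⟩)
    · have hrest : ∑ a ∈ F.support with a ∉ B, coeff a F * ∏ i, f i ^ a i ∈
          Ideal.span (Set.range f) ^ (d + 1) := by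
        refine Ideal.sum_mem _ fun a ha ↦ ?_
        rw [Finset.mem_filter, mem_support_iff] at ha
        rw [pow_succ', ← ((hF a).2 ha.1).2]
        exact Ideal.mul_mem_mul (hcF a ha.2) (prod_pow_mem_pow_degree a)
      have := Ideal.add_mem _ hFy' hrest
      rw [eval_eq', ← Finset.sum_filter_add_sum_filter_not _ (· ∈ B)] at this
      convert this using 1
      ring

end MonomialIdeal

/-- Ideals in a Noetherian local ring are closed in the `I`-adic topology. -/
lemma Ideal.mem_of_forall_exists_sub_mem_pow {R : Type*} [CommRing R] [IsNoetherianRing R]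
    [IsLocalRing R] {I J : Ideal R} (hI : I ≠ ⊤) {x : R}
    (h : ∀ d, ∃ z ∈ J, x - z ∈ I ^ d) : x ∈ J := by
  rw [← Ideal.Quotient.eq_zero_iff_mem, ← Submodule.mem_bot R,
    ← Ideal.iInf_pow_smul_eq_bot_of_isLocalRing (M := R ⧸ J) I hI, Submodule.mem_iInf]
  intro d
  obtain ⟨z, hz, hxz⟩ := h d
  have hx : Ideal.Quotient.mk J x = (x - z) • (1 : R ⧸ J) := by
    rw [Algebra.smul_def, mul_one, Ideal.Quotient.algebraMap_eq, map_sub,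
      Ideal.Quotient.eq_zero_iff_mem.mpr hz, sub_zero]
  rw [hx]
  exact Submodule.smul_mem_smul hxz trivial

/-- In a regular local ring, the intersection of two monomial ideals in a regular system of
parameters is generated by the common monomials. -/
theorem monomialIdeal_inf_le {R ι : Type*} [CommRing R] [IsNoetherianRing R]
    [IsLocalRing R] [Fintype ι] (f : ι → R)
    (hgen : IsLocalRing.maximalIdeal R = Ideal.span (Set.range f))
    (hmin : ∀ i, f i ∉ Ideal.span (f '' {j | j ≠ i}))
    (hreg : ringKrullDim R = Fintype.card ι) {A B : Set (ι →₀ ℕ)}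
    (hA : IsUpperSet A) (hB : IsUpperSet B) :
    monomialIdeal f A ⊓ monomialIdeal f B ≤ monomialIdeal f (A ∩ B) := by
  have hf := isQuasiRegularOn_of_regularSystem f hgen hmin hreg Finset.univ
  rw [Finset.coe_univ] at hf
  rintro x ⟨hxA, hxB⟩
  exact Ideal.mem_of_forall_exists_sub_mem_pow
    (hgen ▸ (IsLocalRing.maximalIdeal.isMaximal R).ne_top)
    (exists_sub_mem_monomialIdeal_inf_pow hf hA hB hxA hxB)

lemma monomialValIdeal_eq_monomialIdeal {R : Type*} [CommRing R] {n : ℕ} (f : Fin n → R)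
    (m : Fin n → ℕ) (μ : ℕ) :
    monomialValIdeal f m μ = monomialIdeal f {a | μ ≤ ∑ i, a i * m i} := by
  rw [monomialValIdeal, monomialIdeal]
  congr 1
  ext x
  constructor
  · rintro ⟨a, ha, rfl⟩
    exact ⟨Finsupp.equivFunOnFinite.symm a, by simpa using ha, by simp⟩
  · rintro ⟨a, ha, rfl⟩
    exact ⟨a, ha, rfl⟩

lemma isUpperSet_le_sum_mul {ι : Type*} [Fintype ι] (m : ι → ℕ) (μ : ℕ) :
    IsUpperSet {a : ι →₀ ℕ | μ ≤ ∑ i, a i * m i} := fun a _ hab ha ↦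
  le_trans (show μ ≤ ∑ i, a i * m i from ha)
    (Finset.sum_le_sum fun i _ ↦ Nat.mul_le_mul_right _ (hab i))

/-- Let `R` be a Noetherian regular local ring whose maximal ideal is minimally generated
by a regular system of parameters `f 1, …, f n` (so `ringKrullDim R = n`).  Then for all
`m m' : ℕⁿ` and positive integers `μ μ'` one has
`I_m^μ ∩ I_{m'}^{μ'} ⊆ I_{m+m'}^{μ+μ'}`. -/
theorem monomialValIdeal_inf_le {R : Type*} [CommRing R] [IsNoetherianRing R]
    [IsLocalRing R] {n : ℕ} (f : Fin n → R)
    (hgen : IsLocalRing.maximalIdeal R = Ideal.span (Set.range f))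
    (hmin : ∀ i : Fin n, f i ∉ Ideal.span (f '' {j | j ≠ i}))
    (hreg : ringKrullDim R = n)
    (m m' : Fin n → ℕ) (μ μ' : ℕ) (hμ : 0 < μ) (hμ' : 0 < μ') :
    monomialValIdeal f m μ ⊓ monomialValIdeal f m' μ' ≤
      monomialValIdeal f (m + m') (μ + μ') := by
  simp only [monomialValIdeal_eq_monomialIdeal]
  refine (monomialIdeal_inf_le f hgen hmin (by simpa using hreg) (isUpperSet_le_sum_mul m μ)
    (isUpperSet_le_sum_mul m' μ')).trans (monomialIdeal_mono ?_)
  rintro a ⟨h, h'⟩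
  simp only [Set.mem_ofPred_eq, Pi.add_apply, mul_add, Finset.sum_add_distrib] at h h' ⊢
  exact add_le_add h h'
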